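/- Fix θ = (σ,δ,α) with σ > 0, δ > 0, α ∈ (0,2), and let p ∈ ℕ. Set Γ_n = √((1−α/2) ln n), M_n = √((2−α) ln n), and Ψ^{(p)}(z) = ∫_{|y|>z} ψ_α^{(p)}(y) dy. There exist C > 0 and N ∈ ℕ such that for all n ≥ N: | ∫_{|y|>Γ_n} ψ_α^{(p)}(y) ψ_α^{(0)}(y) / ( φ(y) + c_α w_n(θ)^α ψ_α^{(0)}(y) ) dy − Ψ^{(p)}(M_n) / (c_α w_n(θ)^α) | ≤ C (n^{1−α/2}/(ln n)^{α/2}) · (ln(ln n))^{p+1}/(ln n)^{min(1/2, α)}. -/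

import Mathlib

open MeasureTheory Filter Set Topology Matrix

noncomputable section

namespace LevyLAN

/-- Standard Gaussian density `φ`. -/
def gauss (y : ℝ) : ℝ := (Real.sqrt (2 * Real.pi))⁻¹ * Real.exp (-(y ^ 2) / 2)

/-- Symmetric `α`-stable density `φ_α`, defined by Fourier inversion. -/
def stableDensity (α z : ℝ) : ℝ :=
  (2 * Real.pi)⁻¹ * ∫ u : ℝ, Real.cos (z * u) * Real.exp (-(|u| ^ α))

/-- `∂_α φ_α`. -/
def stableDensityDalpha (α z : ℝ) : ℝ :=
  -(2 * Real.pi)⁻¹ * ∫ u : ℝ, Real.cos (z * u) * |u| ^ α * Real.log |u| * Real.exp (-(|u| ^ α))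

/-- The operator `(D f) y = (y * f y)' = f y + y * f' y`. -/
def Dop (f : ℝ → ℝ) (y : ℝ) : ℝ := f y + y * deriv f y

/-- `f_α(y, w)`. -/
def fFun (α y w : ℝ) : ℝ := ∫ z : ℝ, gauss (y - w * z) * stableDensity α z

/-- `g_α(y, w)`. -/
def gFun (α y w : ℝ) : ℝ := ∫ z : ℝ, Dop gauss (y - w * z) * stableDensity α z

/-- `h_α(y, w)`. -/
def hFun (α y w : ℝ) : ℝ := ∫ z : ℝ, gauss (y - w * z) * Dop (stableDensity α) z

/-- `k_α(y, w)`. -/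
def kFun (α y w : ℝ) : ℝ := ∫ z : ℝ, gauss (y - w * z) * stableDensityDalpha α z

/-- `c_α`. -/
def cAlpha (α : ℝ) : ℝ :=
  if α = 1 then 1 / Real.pi
  else -(α * (α - 1)) / (2 * Real.Gamma (2 - α) * Real.cos (Real.pi * α / 2))

/-- `w_n(θ) = n^{1/2 - 1/α} δ / σ`. -/
def wn (n : ℕ) (σ δ α : ℝ) : ℝ := (n : ℝ) ^ ((1 : ℝ) / 2 - 1 / α) * δ / σ

/-- `l_α(y, w)` (it depends on `n`). -/
def lFun (n : ℕ) (α y w : ℝ) : ℝ :=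
  ((Real.log n - Real.log (Real.log n)) / (2 * α) - Real.log n / α ^ 2) * hFun α y w
    + kFun α y w

def kappa0 (σ δ α : ℝ) : ℝ := 2 * cAlpha α / (α * (2 - α) ^ (α / 2)) * (δ / σ) ^ α

def kappa1 (σ δ α : ℝ) : ℝ :=
  Real.log (δ / σ) + deriv cAlpha α / cAlpha α - Real.log (2 - α) / 2 - 1 / α

/-- The density `p_{1/n}(y, θ)`, with parameter `θ = (σ, δ, α) : Fin 3 → ℝ`. -/
def pdens (n : ℕ) (θ : Fin 3 → ℝ) (y : ℝ) : ℝ :=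
  Real.sqrt n / θ 0 * fFun (θ 2) (Real.sqrt n * y / θ 0) (wn n (θ 0) (θ 1) (θ 2))

/-- The log-likelihood `ln L_n(θ)`. -/
def logLik (n : ℕ) (θ : Fin 3 → ℝ) (x : Fin n → ℝ) : ℝ :=
  ∑ i, Real.log (pdens n θ (x i))

/-- Partial derivative in the `j`-th parameter coordinate. -/
def pderiv (j : Fin 3) (F : (Fin 3 → ℝ) → ℝ) (θ : Fin 3 → ℝ) : ℝ :=
  deriv (fun t => F (Function.update θ j t)) (θ j)

/-- The score `G_n(θ) = ∇_θ ln L_n(θ)`. -/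
def scoreVec (n : ℕ) (θ : Fin 3 → ℝ) (x : Fin n → ℝ) : Fin 3 → ℝ :=
  fun j => pderiv j (fun θ' => logLik n θ' x) θ

/-- The Hessian matrix `J_n(θ)` of the log-likelihood. -/
def hessMat (n : ℕ) (θ : Fin 3 → ℝ) (x : Fin n → ℝ) : Matrix (Fin 3) (Fin 3) ℝ :=
  Matrix.of fun i j => pderiv i (fun θ' => pderiv j (fun θ'' => logLik n θ'' x) θ') θ

def rate (n : ℕ) (α : ℝ) : ℝ := Real.log n ^ (α / 4) / (n : ℝ) ^ (α / 4)

/-- The rate matrix `u_n(θ)`. -/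
def un (n : ℕ) (θ : Fin 3 → ℝ) : Matrix (Fin 3) (Fin 3) ℝ :=
  !![1 / Real.sqrt n, 0, 0;
     0, rate n (θ 2), -(rate n (θ 2) * (θ 1 / (2 * θ 2)) * (Real.log n - Real.log (Real.log n)));
     0, 0, rate n (θ 2)]

/-- The information matrix `I(θ)`. -/
def Imat (θ : Fin 3 → ℝ) : Matrix (Fin 3) (Fin 3) ℝ :=
  !![2 / θ 0 ^ 2, 0, 0;
     0, θ 2 ^ 2 / θ 1 ^ 2 * kappa0 (θ 0) (θ 1) (θ 2),
        θ 2 / θ 1 * kappa0 (θ 0) (θ 1) (θ 2) * kappa1 (θ 0) (θ 1) (θ 2);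
     0, θ 2 / θ 1 * kappa0 (θ 0) (θ 1) (θ 2) * kappa1 (θ 0) (θ 1) (θ 2),
        kappa0 (θ 0) (θ 1) (θ 2) * (kappa1 (θ 0) (θ 1) (θ 2) ^ 2 + 1 / θ 2 ^ 2)]

/-- `ℙ_n`, the `n`-fold product of the law with Lebesgue density `p_{1/n}(·, θ)`. -/
def Pn (n : ℕ) (θ : Fin 3 → ℝ) : Measure (Fin n → ℝ) :=
  Measure.pi fun _ => MeasureTheory.volume.withDensity fun y => ENNReal.ofReal (pdens n θ y)

/-- The standard Gaussian measure on `ℝ³`. -/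
def stdGauss3 : Measure (Fin 3 → ℝ) :=
  Measure.pi fun _ => ProbabilityTheory.gaussianReal 0 1

/-- Euclidean (Frobenius) norm of a real 3×3 matrix. -/
def frobNorm (M : Matrix (Fin 3) (Fin 3) ℝ) : ℝ := Real.sqrt (∑ i, ∑ j, M i j ^ 2)

/-- Euclidean norm of a vector of `ℝ³`. -/
def vecNorm (v : Fin 3 → ℝ) : ℝ := Real.sqrt (∑ j, v j ^ 2)

/-- The admissible families of functions `ψ_α^{(p)}`. -/
structure IsPsiFamily (ψ : ℝ → ℕ → ℝ → ℝ) : Prop where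
  contDiff : ∀ α ∈ Set.Ioo (0 : ℝ) 2, ∀ p : ℕ, ContDiff ℝ 2 (ψ α p)
  pos : ∀ α ∈ Set.Ioo (0 : ℝ) 2, ∀ p : ℕ, ∀ y : ℝ, 0 < ψ α p y
  even : ∀ α ∈ Set.Ioo (0 : ℝ) 2, ∀ p : ℕ, ∀ y : ℝ, ψ α p (-y) = ψ α p y
  eq_one : ∀ α ∈ Set.Ioo (0 : ℝ) 2, ∀ p : ℕ, ∀ y : ℝ, |y| ≤ 1 → ψ α p y = 1
  eq_tail : ∀ α ∈ Set.Ioo (0 : ℝ) 2, ∀ p : ℕ, ∀ y : ℝ, 3 ≤ |y| →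
    ψ α p y = Real.log |y| ^ p / |y| ^ (α + 1)
  unifBound : ∀ K : Set ℝ, K ⊆ Set.Ioo (0 : ℝ) 2 → IsCompact K → ∀ p : ℕ,
    ∃ c > (0 : ℝ), ∃ C : ℝ, ∀ α ∈ K, ∀ y : ℝ, 1 ≤ |y| → |y| ≤ 3 →
      c ≤ ψ α p y ∧ ψ α p y ≤ C

/-- `𝓘_α^{(k,l)}`. -/
def Ical (ψ : ℝ → ℕ → ℝ → ℝ) (α : ℝ) (k l : ℕ) (y : ℝ) : ℝ :=
  ∫ z in {z : ℝ | 1 < |z|}, Dop^[k] gauss (y - z) * ψ α l z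

/-- `f_α^{(k,l,m)}`. -/
def fklm (α : ℝ) (k l m : ℕ) (y w : ℝ) : ℝ :=
  ∫ z : ℝ, Dop^[k] gauss (y - w * z)
    * Dop^[l] (fun z' => iteratedDeriv m (fun a => stableDensity a z') α) z

def Gamman (n : ℕ) (α : ℝ) : ℝ := Real.sqrt ((1 - α / 2) * Real.log n)

def Mn (n : ℕ) (α : ℝ) : ℝ := Real.sqrt ((2 - α) * Real.log n)

def Kconst (σ δ α : ℝ) : ℝ := deriv cAlpha α + cAlpha α * Real.log (δ / σ)
lemma gauss_pos (y : ℝ) : 0 < gauss y := by unfold gauss; positivity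

lemma gauss_continuous : Continuous gauss := by unfold gauss; fun_prop

lemma gauss_neg (y : ℝ) : gauss (-y) = gauss y := by simp [gauss]

lemma cAlpha_pos {α : ℝ} (hα : α ∈ Set.Ioo (0 : ℝ) 2) : 0 < cAlpha α := by
  obtain ⟨h0, h2⟩ := hα
  have hG : 0 < Real.Gamma (2 - α) := Real.Gamma_pos_of_pos (by linarith)
  have hpi := Real.pi_pos
  unfold cAlpha
  split_ifs with h
  · positivity
  · rcases lt_or_gt_of_ne h with h1 | h1
    · have hc : 0 < Real.cos (Real.pi * α / 2) :=
        Real.cos_pos_of_mem_Ioo ⟨by nlinarith, by nlinarith⟩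
      have : 0 < -(α * (α - 1)) := by nlinarith
      positivity
    · have hc : Real.cos (Real.pi * α / 2) < 0 :=
        Real.cos_neg_of_pi_div_two_lt_of_lt (by nlinarith) (by nlinarith)
      apply div_pos_of_neg_of_neg
      · nlinarith
      · exact mul_neg_of_pos_of_neg (by positivity) hc

lemma log_pow_le (p : ℕ) (s : ℝ) (hs : 0 < s) :
    ∃ C > (0 : ℝ), ∀ y ≥ (1 : ℝ), Real.log y ^ p ≤ C * y ^ s := by
  -- `log y ≤ y ^ t / t` with `t = s / (p + 1)`
  have ht : 0 < s / (p + 1 : ℝ) := by positivity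
  refine ⟨(1 / (s / (p + 1 : ℝ))) ^ p, by positivity, fun y hy => ?_⟩
  have hy0 : (0 : ℝ) < y := by linarith
  have h1 := Real.log_le_rpow_div hy0.le ht
  have h0 := Real.log_nonneg hy
  calc Real.log y ^ p ≤ (y ^ (s / (p + 1 : ℝ)) / (s / (p + 1 : ℝ))) ^ p :=
        pow_le_pow_left₀ h0 h1 p
    _ = (1 / (s / (p + 1 : ℝ))) ^ p * y ^ (s / (p + 1 : ℝ) * p) := by
        rw [Real.rpow_mul hy0.le, Real.rpow_natCast, ← mul_pow]; congr 1; ring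
    _ ≤ _ := by
        apply mul_le_mul_of_nonneg_left _ (by positivity)
        apply Real.rpow_le_rpow_of_exponent_le hy
        rw [div_mul_eq_mul_div, div_le_iff₀ (by positivity)]
        nlinarith

lemma even_integral (F : ℝ → ℝ) (hF : ∀ y, F (-y) = F y) (z : ℝ) (hz : 0 ≤ z) :
    ∫ y in {y : ℝ | z < |y|}, F y = 2 * ∫ y in Ioi z, F y := by
  have hm : MeasurableSet {y : ℝ | z < |y|} :=
    measurableSet_lt measurable_const measurable_id.abs
  have hFa : ∀ y, F |y| = F y := by
    intro y
    rcases abs_choice y with h | h <;> rw [h]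
    exact hF y
  have h1 : ∀ y, ({y : ℝ | z < |y|}).indicator F y = (Ioi z).indicator F |y| := by
    intro y
    by_cases h : z < |y|
    · rw [indicator_of_mem (by exact h), indicator_of_mem (by exact h), hFa]
    · rw [indicator_of_notMem (by exact h), indicator_of_notMem (by exact h)]
  rw [← integral_indicator hm]
  simp_rw [h1]
  rw [integral_comp_abs (f := (Ioi z).indicator F), setIntegral_indicator measurableSet_Ioi]
  congr 3
  ext x
  simp only [mem_inter_iff, mem_Ioi]
  constructor
  · exact fun h => h.2
  · exact fun h => ⟨lt_of_le_of_lt hz h, h⟩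

lemma integrable_P {α : ℝ} (hα : 0 < α) (p : ℕ) (P : ℝ → ℝ) (hPc : Continuous P)
    (hP : ∀ y, 3 ≤ y → P y = Real.log y ^ p / y ^ (α + 1)) (z : ℝ) (hz : 3 ≤ z) :
    IntegrableOn P (Ioi z) := by
  obtain ⟨C, hC, hCb⟩ := log_pow_le p (α / 2) (by linarith)
  have hi : IntegrableOn (fun y : ℝ => C * y ^ (-(α / 2) - 1)) (Ioi z) :=
    (integrableOn_Ioi_rpow_of_lt (by linarith) (by linarith)).const_mul C
  refine Integrable.mono' hi hPc.aestronglyMeasurable ?_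
  refine (ae_restrict_iff' measurableSet_Ioi).2 (Eventually.of_forall fun y hy => ?_)
  have hy3 : z < y := hy
  have hy0 : 0 < y := by linarith
  have hl : 0 ≤ Real.log y := Real.log_nonneg (by linarith)
  rw [hP y (by linarith), Real.norm_of_nonneg (by positivity), div_le_iff₀ (by positivity),
    mul_assoc, ← Real.rpow_add hy0]
  have he : -(α / 2) - 1 + (α + 1) = α / 2 := by ring
  rw [he]
  exact hCb y (by linarith)

lemma exp_integral (Y : ℝ) (hY : 0 ≤ Y) :
    IntegrableOn (fun y : ℝ => y * Real.exp (-(y ^ 2) / 2)) (Ioi Y) ∧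
    ∫ y in Ioi Y, y * Real.exp (-(y ^ 2) / 2) = Real.exp (-(Y ^ 2) / 2) := by
  have hd : ∀ x ∈ Ici Y, HasDerivAt (fun y : ℝ => - Real.exp (-(y ^ 2) / 2))
      (x * Real.exp (-(x ^ 2) / 2)) x := by
    intro x _
    have h1 : HasDerivAt (fun y : ℝ => -(y ^ 2) / 2) (-x) x := by
      have := ((hasDerivAt_pow 2 x).neg).div_const 2
      have he : -x = -(((2 : ℕ) : ℝ) * x ^ (2 - 1)) / 2 := by push_cast; norm_num; ring
      rw [he]
      exact this
    have h2 := h1.exp.neg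
    have he : x * Real.exp (-(x ^ 2) / 2) = -(Real.exp (-(x ^ 2) / 2) * -x) := by ring
    rw [he]
    exact h2
  have ht : Tendsto (fun y : ℝ => - Real.exp (-(y ^ 2) / 2)) atTop (𝓝 0) := by
    have h2 : Tendsto (fun y : ℝ => y ^ 2 / 2) atTop atTop :=
      (tendsto_pow_atTop (two_ne_zero)).atTop_div_const (by norm_num)
    have h3 := (Real.tendsto_exp_neg_atTop_nhds_zero.comp h2).neg
    simp only [neg_zero] at h3
    refine h3.congr fun y => ?_
    simp [neg_div]
  have hi : IntegrableOn (fun y : ℝ => y * Real.exp (-(y ^ 2) / 2)) (Ioi Y) :=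
    integrableOn_Ioi_deriv_of_nonneg' hd
      (fun x hx => mul_nonneg (hY.trans (le_of_lt hx)) (Real.exp_pos _).le) ht
  refine ⟨hi, ?_⟩
  rw [integral_Ioi_of_hasDerivAt_of_tendsto' hd hi ht]
  ring

lemma half_bound {α b G M Y Cp : ℝ} (hα : 0 < α) (p : ℕ) (hb : 0 < b) (hG : 3 ≤ G) (hGM : G ≤ M)
    (hMY : M ≤ Y) (P Q : ℝ → ℝ) (hPc : Continuous P) (hQc : Continuous Q)
    (hP0 : ∀ y, 0 < P y) (hQ0 : ∀ y, 0 < Q y)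
    (hP : ∀ y, 3 ≤ y → P y = Real.log y ^ p / y ^ (α + 1))
    (hQ : ∀ y, 3 ≤ y → Q y = 1 / y ^ (α + 1))
    (hCp : ∀ y ≥ (1 : ℝ), Real.log y ^ p ≤ Cp * y) :
    |(∫ y in Ioi G, P y * Q y / (gauss y + b * Q y)) - (∫ y in Ioi M, P y) / b| ≤
      Real.log M ^ p / G ^ (α + 1) * (1 / G ^ (α + 1))
          * (Real.sqrt (2 * Real.pi) * Real.exp (M ^ 2 / 2)) * (M - G)
        + Real.log Y ^ p / M ^ (α + 1) / b * (Y - M)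
        + Cp / b ^ 2 * (Real.sqrt (2 * Real.pi))⁻¹ * Real.exp (-(Y ^ 2) / 2) := by
  set F : ℝ → ℝ := fun y => P y * Q y / (gauss y + b * Q y) with hF
  have hden : ∀ y, 0 < gauss y + b * Q y := fun y =>
    add_pos (gauss_pos y) (mul_pos hb (hQ0 y))
  have hFc : Continuous F :=
    (hPc.mul hQc).div (gauss_continuous.add (continuous_const.mul hQc)) fun y => (hden y).ne'
  have hF0 : ∀ y, 0 ≤ F y := fun y =>
    div_nonneg (mul_pos (hP0 y) (hQ0 y)).le (hden y).le
  have hdiff : ∀ y, P y / b - F y = P y * gauss y / (b * (gauss y + b * Q y)) := by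
    intro y
    have := (hden y).ne'
    simp only [hF]
    field_simp
    ring
  have hdiff0 : ∀ y, 0 ≤ P y / b - F y := by
    intro y
    rw [hdiff]
    have := hden y; have := hP0 y; have := gauss_pos y
    positivity
  have hPi : ∀ z, 3 ≤ z → IntegrableOn P (Ioi z) := fun z hz => integrable_P hα p P hPc hP z hz
  have hFi : ∀ z, 3 ≤ z → IntegrableOn F (Ioi z) := by
    intro z hz
    refine Integrable.mono' ((hPi z hz).div_const b) hFc.aestronglyMeasurable ?_
    refine Eventually.of_forall fun y => ?_
    rw [Real.norm_of_nonneg (hF0 y)]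
    linarith [hdiff0 y]
  have hDi : ∀ z, 3 ≤ z → IntegrableOn (fun y => P y / b - F y) (Ioi z) := fun z hz =>
    ((hPi z hz).div_const b).sub (hFi z hz)
  have split1 : ∫ y in Ioi G, F y = (∫ y in Ioc G M, F y) + ∫ y in Ioi M, F y := by
    rw [← Ioc_union_Ioi_eq_Ioi hGM, setIntegral_union (Ioc_disjoint_Ioi le_rfl)
      measurableSet_Ioi ((hFi G hG).mono_set Ioc_subset_Ioi_self) (hFi M (by linarith))]
  have split2 : ∫ y in Ioi M, (P y / b - F y) = (∫ y in Ioc M Y, (P y / b - F y))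
      + ∫ y in Ioi Y, (P y / b - F y) := by
    rw [← Ioc_union_Ioi_eq_Ioi hMY, setIntegral_union (Ioc_disjoint_Ioi le_rfl)
      measurableSet_Ioi ((hDi M (by linarith)).mono_set Ioc_subset_Ioi_self)
      (hDi Y (by linarith))]
  have hsub : ∫ y in Ioi M, (P y / b - F y) = (∫ y in Ioi M, P y) / b - ∫ y in Ioi M, F y := by
    rw [integral_sub ((hPi M (by linarith)).div_const b) (hFi M (by linarith)), integral_div]
  have hA0 : 0 ≤ ∫ y in Ioc G M, F y := integral_nonneg hF0
  have hB0 : 0 ≤ ∫ y in Ioc M Y, (P y / b - F y) := integral_nonneg hdiff0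
  have hC0 : 0 ≤ ∫ y in Ioi Y, (P y / b - F y) := integral_nonneg hdiff0
  have hs2 : 0 < Real.sqrt (2 * Real.pi) := Real.sqrt_pos.2 (by positivity)
  have hA : ∫ y in Ioc G M, F y ≤ Real.log M ^ p / G ^ (α + 1) * (1 / G ^ (α + 1))
          * (Real.sqrt (2 * Real.pi) * Real.exp (M ^ 2 / 2)) * (M - G) := by
    have h := norm_setIntegral_le_of_norm_le_const (μ := volume) (s := Ioc G M) (f := F)
      (C := Real.log M ^ p / G ^ (α + 1) * (1 / G ^ (α + 1))
          * (Real.sqrt (2 * Real.pi) * Real.exp (M ^ 2 / 2))) measure_Ioc_lt_top ?_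
    · rw [Real.volume_real_Ioc_of_le hGM] at h
      exact (le_abs_self _).trans h
    · rintro y ⟨hy1, hy2⟩
      have hy0 : 0 < y := by linarith
      have hG0 : 0 < G := by linarith
      rw [Real.norm_of_nonneg (hF0 y)]
      have hl : 0 ≤ Real.log y := Real.log_nonneg (by linarith)
      have hlM : 0 ≤ Real.log M := Real.log_nonneg (by linarith)
      have hpow : G ^ (α + 1) ≤ y ^ (α + 1) :=
        Real.rpow_le_rpow hG0.le hy1.le (by linarith)
      have h1 : P y ≤ Real.log M ^ p / G ^ (α + 1) := by
        rw [hP y (by linarith)]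
        have : Real.log y ≤ Real.log M := Real.log_le_log hy0 hy2
        gcongr
      have h2 : Q y ≤ 1 / G ^ (α + 1) := by
        rw [hQ y (by linarith)]
        gcongr
      have h3 : (gauss y)⁻¹ ≤ Real.sqrt (2 * Real.pi) * Real.exp (M ^ 2 / 2) := by
        unfold gauss
        rw [mul_inv, inv_inv, ← Real.exp_neg]
        gcongr
        nlinarith
      calc F y ≤ P y * Q y * (gauss y)⁻¹ := by
            simp only [hF]
            rw [← div_eq_mul_inv]
            apply div_le_div_of_nonneg_left (mul_pos (hP0 y) (hQ0 y)).le (gauss_pos y)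
            linarith [mul_pos hb (hQ0 y)]
        _ ≤ _ := by
            apply mul_le_mul _ h3 (inv_nonneg.2 (gauss_pos y).le) (by positivity)
            exact mul_le_mul h1 h2 (hQ0 y).le (by positivity)
  have hB : ∫ y in Ioc M Y, (P y / b - F y) ≤ Real.log Y ^ p / M ^ (α + 1) / b * (Y - M) := by
    have h := norm_setIntegral_le_of_norm_le_const (μ := volume) (s := Ioc M Y)
      (f := fun y => P y / b - F y)
      (C := Real.log Y ^ p / M ^ (α + 1) / b) measure_Ioc_lt_top ?_
    · rw [Real.volume_real_Ioc_of_le hMY] at h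
      exact (le_abs_self _).trans h
    · rintro y ⟨hy1, hy2⟩
      have hy0 : 0 < y := by linarith
      have hM0 : 0 < M := by linarith
      rw [Real.norm_of_nonneg (hdiff0 y)]
      have hl : 0 ≤ Real.log y := Real.log_nonneg (by linarith)
      have hpow : M ^ (α + 1) ≤ y ^ (α + 1) :=
        Real.rpow_le_rpow hM0.le hy1.le (by linarith)
      have h1 : P y ≤ Real.log Y ^ p / M ^ (α + 1) := by
        rw [hP y (by linarith)]
        have : Real.log y ≤ Real.log Y := Real.log_le_log hy0 hy2
        have : 0 ≤ Real.log Y := hl.trans this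
        gcongr
      have : P y / b ≤ Real.log Y ^ p / M ^ (α + 1) / b := by gcongr
      linarith [hF0 y]
  have hC : ∫ y in Ioi Y, (P y / b - F y) ≤
      Cp / b ^ 2 * (Real.sqrt (2 * Real.pi))⁻¹ * Real.exp (-(Y ^ 2) / 2) := by
    obtain ⟨he1, he2⟩ := exp_integral Y (by linarith)
    rw [← he2, ← integral_const_mul]
    refine setIntegral_mono_on (hDi Y (by linarith)) (he1.const_mul _) measurableSet_Ioi ?_
    intro y hy
    have hyY : Y < y := hy
    have hy0 : 0 < y := by linarith
    have hPQ : P y = Real.log y ^ p * Q y := by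
      rw [hP y (by linarith), hQ y (by linarith)]; ring
    have hQy := hQ0 y
    have hgy := gauss_pos y
    have hl : 0 ≤ Real.log y := Real.log_nonneg (by linarith)
    rw [hdiff]
    calc P y * gauss y / (b * (gauss y + b * Q y)) ≤ P y * gauss y / (b * (b * Q y)) := by
          have := hP0 y
          gcongr
          linarith
      _ = Real.log y ^ p * (gauss y / b ^ 2) := by
          rw [hPQ]; field_simp
      _ ≤ Cp * y * (gauss y / b ^ 2) := by
          gcongr
          exact hCp y (by linarith)
      _ = _ := by
          unfold gauss; ring
  rw [split1, abs_le]
  constructor <;> linarith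

set_option maxHeartbeats 1000000 in
/-- the key tail-integral estimate. -/
theorem statement18 (σ δ α : ℝ) (hσ : 0 < σ) (hδ : 0 < δ) (hα : α ∈ Set.Ioo (0 : ℝ) 2)
    (p : ℕ) (ψ : ℝ → ℕ → ℝ → ℝ) (hψ : IsPsiFamily ψ) :
    ∃ C > (0 : ℝ), ∃ N : ℕ, ∀ n ≥ N,
      |(∫ y in {y : ℝ | Gamman n α < |y|},
            ψ α p y * ψ α 0 y / (gauss y + cAlpha α * wn n σ δ α ^ α * ψ α 0 y))
          - (∫ y in {y : ℝ | Mn n α < |y|}, ψ α p y) / (cAlpha α * wn n σ δ α ^ α)| ≤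
        C * ((n : ℝ) ^ (1 - α / 2) / Real.log n ^ (α / 2)) *
          (Real.log (Real.log n) ^ (p + 1) / Real.log n ^ (min (1 / 2 : ℝ) α)) := by
  have hα' := hα
  obtain ⟨h0, h2⟩ := hα'
  have hc := cAlpha_pos hα
  set a : ℝ := 1 - α / 2 with ha
  have ha0 : 0 < a := by rw [ha]; linarith
  have ha1 : a ≤ 1 := by rw [ha]; linarith
  set κ : ℝ := cAlpha α * (δ / σ) ^ α with hκ
  have hκ0 : 0 < κ := by positivity
  obtain ⟨Cp, hCp0, hCp⟩ := log_pow_le p 1 one_pos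
  simp only [Real.rpow_one] at hCp
  set s : ℝ := Real.sqrt (2 * Real.pi) with hs
  have hs0 : 0 < s := Real.sqrt_pos.2 (by positivity)
  set A : ℝ := a ^ ((α + 1) / 2) with hA
  have hA0 : 0 < A := by positivity
  have hlim : Tendsto (fun n : ℕ => Real.log (n : ℝ)) atTop atTop :=
    Real.tendsto_log_atTop.comp tendsto_natCast_atTop_atTop
  obtain ⟨N, hN⟩ := eventually_atTop.1 (hlim.eventually_ge_atTop (6 + 9 / a))
  refine ⟨2 * (2 * s / A ^ 2 + 4 / (κ * A) + Cp / (κ ^ 2 * s)), by positivity, max N 1,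
    fun n hn => ?_⟩
  have hLn := hN n (le_trans (le_max_left _ _) hn)
  have hn1 : 1 ≤ n := le_trans (le_max_right _ _) hn
  have hn0 : (0 : ℝ) < n := by exact_mod_cast hn1
  have hM : Mn n α = Real.sqrt (2 * a * Real.log n) := by
    unfold Mn; congr 1; rw [ha]; ring
  have hG : Gamman n α = Real.sqrt (a * Real.log n) := rfl
  have hE : (n : ℝ) ^ a = Real.exp (a * Real.log n) := by
    rw [Real.rpow_def_of_pos hn0, mul_comm]
  have hb : cAlpha α * wn n σ δ α ^ α = κ / (n : ℝ) ^ a := by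
    unfold wn
    rw [mul_div_assoc, Real.mul_rpow (by positivity) (by positivity), ← Real.rpow_mul hn0.le,
      hκ, div_eq_mul_inv _ ((n : ℝ) ^ a), ← Real.rpow_neg hn0.le]
    have he : (1 / 2 - 1 / α) * α = -a := by rw [ha]; field_simp; ring
    rw [he]; ring
  rw [hb, hM, hG]
  set L : ℝ := Real.log n with hL
  set E : ℝ := (n : ℝ) ^ a with hEd
  have hE0 : 0 < E := by positivity
  have h9a : 0 < 9 / a := by positivity
  have hL6 : 6 ≤ L := by linarith
  have hL0 : 0 < L := by linarith
  have haL : 9 ≤ a * L := by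
    have : 9 / a ≤ L := by linarith
    rw [div_le_iff₀ ha0] at this
    linarith
  set l : ℝ := Real.log L with hl
  have hl1 : 1 ≤ l := by
    rw [hl, Real.le_log_iff_exp_le hL0]
    linarith [Real.exp_one_lt_d9]
  have hlL : l ≤ L := Real.log_le_self hL0.le
  set G : ℝ := Real.sqrt (a * L) with hGd
  set M : ℝ := Real.sqrt (2 * a * L) with hMd
  set Y : ℝ := Real.sqrt (2 * a * L + 4 * l) with hYd
  have hG3 : 3 ≤ G := Real.le_sqrt_of_sq_le (by linarith)
  have hGM : G ≤ M := Real.sqrt_le_sqrt (by linarith)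
  have hMY : M ≤ Y := Real.sqrt_le_sqrt (by linarith)
  have hM2 : M ^ 2 = 2 * a * L := Real.sq_sqrt (by linarith)
  have hY2 : Y ^ 2 = 2 * a * L + 4 * l := Real.sq_sqrt (by linarith)
  have hYM : Y - M ≤ 4 * l := by
    have hM0 : 0 ≤ M := by linarith
    nlinarith only [hM2, hY2, hl1, hM0, hMY, hG3, hGM]
  have hYL : Y ≤ L := Real.sqrt_le_iff.2 ⟨hL0.le, by
    have h3 := mul_le_mul_of_nonneg_right ha1 hL0.le
    have h4 := mul_le_mul_of_nonneg_right hL6 hL0.le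
    nlinarith only [h3, h4, hlL]⟩
  have hlY : Real.log Y ≤ l := Real.log_le_log (by linarith) hYL
  have hlM : Real.log M ≤ l := Real.log_le_log (by linarith) (hMY.trans hYL)
  have hlM0 : 0 ≤ Real.log M := Real.log_nonneg (by linarith)
  have hlY0 : 0 ≤ Real.log Y := Real.log_nonneg (by linarith)
  set X : ℝ := L ^ ((α + 1) / 2) with hX
  have hX0 : 0 < X := by positivity
  have hGX : G ^ (α + 1) = A * X := by
    rw [hGd, Real.sqrt_eq_rpow, ← Real.rpow_mul (by linarith), hA, hX,
      ← Real.mul_rpow ha0.le hL0.le]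
    congr 1; ring
  have hMX : A * X ≤ M ^ (α + 1) := by
    rw [← hGX]; exact Real.rpow_le_rpow (by linarith) hGM (by linarith)
  have hMG : M - G ≤ 2 * X := by
    have h1 : L ^ (1 / 2 : ℝ) ≤ X :=
      Real.rpow_le_rpow_of_exponent_le (by linarith) (by linarith)
    rw [← Real.sqrt_eq_rpow] at h1
    have h3 : M ≤ 2 * Real.sqrt L := by
      rw [hMd, Real.sqrt_le_iff]
      refine ⟨by positivity, ?_⟩
      rw [mul_pow, Real.sq_sqrt hL0.le]
      have := mul_le_mul_of_nonneg_right ha1 hL0.le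
      linarith
    linarith
  have hexpM : Real.exp (M ^ 2 / 2) = E := by
    rw [hM2, hE]; congr 1; ring
  have hexpY : Real.exp (-(Y ^ 2) / 2) = 1 / (E * L ^ 2) := by
    have hL2 : L ^ 2 = Real.exp (2 * l) := by
      rw [two_mul, Real.exp_add, hl, Real.exp_log hL0]; ring
    rw [hY2, hE, hL2, ← Real.exp_add, one_div, ← Real.exp_neg]
    congr 1; ring
  have hXL : X ≤ L ^ 2 := by
    rw [← Real.rpow_natCast L 2]
    exact Real.rpow_le_rpow_of_exponent_le (by linarith) (by push_cast; linarith)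
  have hlp : (1 : ℝ) ≤ l ^ (p + 1) := one_le_pow₀ hl1
  have hlp' : l ^ p ≤ l ^ (p + 1) := pow_le_pow_right₀ hl1 (by omega)
  have hbpos : 0 < κ / E := by positivity
  have hevP := hψ.even α hα p
  have hevQ := hψ.even α hα 0
  have hint1 : ∫ y in {y : ℝ | G < |y|}, ψ α p y * ψ α 0 y / (gauss y + κ / E * ψ α 0 y)
      = 2 * ∫ y in Ioi G, ψ α p y * ψ α 0 y / (gauss y + κ / E * ψ α 0 y) :=
    even_integral (fun y => ψ α p y * ψ α 0 y / (gauss y + κ / E * ψ α 0 y))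
      (fun y => by simp only [hevP, hevQ, gauss_neg]) G (by linarith)
  have hint2 : ∫ y in {y : ℝ | M < |y|}, ψ α p y = 2 * ∫ y in Ioi M, ψ α p y :=
    even_integral _ hevP M (by linarith)
  have key := half_bound h0 p hbpos hG3 hGM hMY (ψ α p) (ψ α 0) (hψ.contDiff α hα p).continuous
    (hψ.contDiff α hα 0).continuous (hψ.pos α hα p) (hψ.pos α hα 0)
    (fun y hy => by
      have := hψ.eq_tail α hα p y (hy.trans (le_abs_self y))
      rwa [abs_of_nonneg (by linarith)] at this)
    (fun y hy => by
      have := hψ.eq_tail α hα 0 y (hy.trans (le_abs_self y))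
      rwa [abs_of_nonneg (by linarith), pow_zero] at this) hCp
  rw [hGX, hexpM, hexpY, ← hs] at key
  have t1 : Real.log M ^ p / (A * X) * (1 / (A * X)) * (s * E) * (M - G)
      ≤ 2 * s / A ^ 2 * (E * (l ^ (p + 1) / X)) := by
    have hAX : 0 < A * X := by positivity
    calc Real.log M ^ p / (A * X) * (1 / (A * X)) * (s * E) * (M - G)
        ≤ l ^ (p + 1) / (A * X) * (1 / (A * X)) * (s * E) * (2 * X) := by
          have : Real.log M ^ p ≤ l ^ (p + 1) := (pow_le_pow_left₀ hlM0 hlM p).trans hlp'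
          gcongr
      _ = _ := by field_simp
  have t2 : Real.log Y ^ p / M ^ (α + 1) / (κ / E) * (Y - M)
      ≤ 4 / (κ * A) * (E * (l ^ (p + 1) / X)) := by
    calc Real.log Y ^ p / M ^ (α + 1) / (κ / E) * (Y - M)
        ≤ l ^ p / (A * X) / (κ / E) * (4 * l) := by
          gcongr
      _ = _ := by rw [pow_succ]; field_simp
  have t3 : Cp / (κ / E) ^ 2 * s⁻¹ * (1 / (E * L ^ 2))
      ≤ Cp / (κ ^ 2 * s) * (E * (l ^ (p + 1) / X)) := by
    calc Cp / (κ / E) ^ 2 * s⁻¹ * (1 / (E * L ^ 2)) = Cp / (κ ^ 2 * s) * (E * (1 / L ^ 2)) := by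
          field_simp
      _ ≤ _ := by gcongr
  have hfin : l ^ (p + 1) / X ≤ 1 / L ^ (α / 2) * (l ^ (p + 1) / L ^ (min (1 / 2 : ℝ) α)) := by
    have h1 : L ^ (α / 2) * L ^ (min (1 / 2 : ℝ) α) ≤ X := by
      rw [← Real.rpow_add hL0]
      apply Real.rpow_le_rpow_of_exponent_le (by linarith)
      linarith [min_le_left (1 / 2 : ℝ) α]
    calc l ^ (p + 1) / X ≤ l ^ (p + 1) / (L ^ (α / 2) * L ^ (min (1 / 2 : ℝ) α)) := by
          gcongr
      _ = _ := by field_simp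
  rw [hint1, hint2, mul_div_assoc 2 (∫ y in Ioi M, ψ α p y) (κ / E), ← mul_sub, abs_mul, abs_two]
  calc _ ≤ 2 * ((2 * s / A ^ 2 + 4 / (κ * A) + Cp / (κ ^ 2 * s)) * (E * (l ^ (p + 1) / X))) := by
        linarith
    _ ≤ 2 * ((2 * s / A ^ 2 + 4 / (κ * A) + Cp / (κ ^ 2 * s)) *
          (E * (1 / L ^ (α / 2) * (l ^ (p + 1) / L ^ (min (1 / 2 : ℝ) α))))) := by
        gcongr
    _ = _ := by ring

end LevyLAN
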